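/- (Type II Reidemeister move M1) Let u and v be lists of letters with u ++ v nonempty, let i ∈ {1, …, n−1} and ε ∈ {+1, −1}, and let w = u ++ v and w' = u ++ [(i,ε), (i,−ε)] ++ v be braid words on n strands, so that w' is obtained from w by inserting a cancelling pair σ_i^ε σ_i^{−ε}. Then there exist an integer b and a unimodular integer matrix P (det P = ±1) such that M(w') = Pᵀ · (M(w) ⊕ [[b, 1], [1, 0]]) · P, where M(w) ⊕ [[b, 1], [1, 0]] denotes the block-diagonal matrix with blocks M(w) and the 2×2 matrix with rows (b, 1) and (1, 0). In particular, M(w') is obtained from M(w) by a tube addition (addition of the two bands X_1 and X_2) up to unimodular congruence. -/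

import Mathlib

open Matrix

/-- A letter of a braid word: a pair (column, sign). -/
abbrev Letter : Type := ℕ × ℤ

/-- A cycle on the laundry surface: `Sum.inl i` is the circle cycle `C_i` (1-indexed),
`Sum.inr k` is the band cycle `X_{k+1}` (i.e. the band of the letter in position `k`,
0-indexed). -/
abbrev Cyc : Type := ℕ ⊕ ℕ

/-- `w` is a braid word on `n` strands: `n ≥ 2`, `w` nonempty, and each letter `(c, ε)`
has column `1 ≤ c ≤ n - 1` and sign `ε = ±1`. -/
def IsBraidWord (n : ℕ) (w : List Letter) : Prop :=
  2 ≤ n ∧ w ≠ [] ∧ ∀ ℓ ∈ w, 1 ≤ ℓ.1 ∧ ℓ.1 ≤ n - 1 ∧ (ℓ.2 = 1 ∨ ℓ.2 = -1)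

/-- A single B0 move: swap two adjacent letters whose columns differ by more than 1. -/
inductive B0Step : List Letter → List Letter → Prop
  | swap (u v : List Letter) (a b : Letter)
      (h : 1 < (a.1 : ℤ) - (b.1 : ℤ) ∨ 1 < (b.1 : ℤ) - (a.1 : ℤ)) :
      B0Step (u ++ a :: b :: v) (u ++ b :: a :: v)

/-- B0-equivalence: a finite sequence of B0 moves. -/
def B0Equiv : List Letter → List Letter → Prop := Relation.ReflTransGen B0Step

/-- The column of the `k`-th letter (0-indexed) of `w`. -/
def colOf (w : List Letter) (k : ℕ) : ℕ := (w.getD k (0, 0)).1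

/-- The sign of the `k`-th letter (0-indexed) of `w`. -/
def signOf (w : List Letter) (k : ℕ) : ℤ := (w.getD k (0, 0)).2

/-- The band cycles `X_k` with column `c_k ∈ {e - 1, e}`, in decreasing order of `k`. -/
def bandBlock (w : List Letter) (e : ℕ) : List Cyc :=
  ((List.range w.length).reverse.filter fun k => colOf w k == e - 1 || colOf w k == e).map
    Sum.inr

/-- The cycles of `w` in laundry order: for each even `e = 2, 4, …, ≤ n` in increasing
order, the circle `C_e` followed by all bands `X_k` with `c_k ∈ {e-1, e}` in decreasing
order of `k`; then the circles `C_i` for odd `i ≤ n` in decreasing order of `i`. -/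
def laundryList (n : ℕ) (w : List Letter) : List Cyc :=
  (((List.range (n + 1)).filter fun e => e % 2 == 0 && e != 0).flatMap
      fun e => Sum.inl e :: bandBlock w e) ++
    ((List.range (n + 1)).filter fun i => i % 2 == 1).reverse.map Sum.inl

/-- The linking number of (the double push-off of) one cycle of `w` with another. -/
def entry (w : List Letter) : Cyc → Cyc → ℤ
  | Sum.inl _, Sum.inl _ => 0
  | Sum.inr k, Sum.inr l =>
      if k = l then signOf w k
      else if (colOf w l = colOf w k + 1 ∧ k < l) ∨ (colOf w l + 1 = colOf w k ∧ l < k) then 1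
      else 0
  | Sum.inr k, Sum.inl j =>
      if j = colOf w k then -1 else if j = colOf w k + 1 then 1 else 0
  | Sum.inl j, Sum.inr k =>
      if j = colOf w k then -1 else if j = colOf w k + 1 then 1 else 0

/-- The linking matrix `M(w)` of a braid word `w` with `m` letters on `n` strands:
the `(n+m) × (n+m)` integer matrix of linking numbers, rows and columns indexed by the
cycles of `w` in laundry order. -/
def linkMat (n m : ℕ) (w : List Letter) : Matrix (Fin (n + m)) (Fin (n + m)) ℤ :=
  fun p q =>
    entry w ((laundryList n w).getD p (Sum.inl 0)) ((laundryList n w).getD q (Sum.inl 0))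

/-- The block-diagonal matrix `A ⊕ [[b, 1], [1, 0]]`, reindexed by `Fin (s + 2)`. -/
def tubeAdd {s : ℕ} (A : Matrix (Fin s) (Fin s) ℤ) (b : ℤ) :
    Matrix (Fin (s + 2)) (Fin (s + 2)) ℤ :=
  Matrix.reindex finSumFinEquiv finSumFinEquiv
    (Matrix.fromBlocks A 0 0 !![b, 1; 1, 0])

/-- The position in `u ++ [x, y] ++ v` of the `k`-th letter of `u ++ v`, where `a` is the
length of `u`. -/
def shiftIndex (a k : ℕ) : ℕ := if k < a then k else k + 2

/-- The map on cycles induced by inserting two letters at position `a`. -/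
def shiftCyc (a : ℕ) : Cyc → Cyc := Sum.map id (shiftIndex a)

theorem shiftIndex_inj {a k l : ℕ} : shiftIndex a k = shiftIndex a l ↔ k = l := by
  unfold shiftIndex; split_ifs <;> omega

theorem shiftIndex_lt {a k l : ℕ} : shiftIndex a k < shiftIndex a l ↔ k < l := by
  unfold shiftIndex; split_ifs <;> omega

theorem shiftIndex_cases (a k : ℕ) : shiftIndex a k < a ∨ a + 1 < shiftIndex a k := by
  unfold shiftIndex; split_ifs <;> omega

theorem shiftCyc_injective (a : ℕ) : Function.Injective (shiftCyc a) :=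
  Function.Injective.sumMap Function.injective_id fun _ _ h => shiftIndex_inj.1 h

theorem getD_insert_shiftIndex {α : Type*} (u v : List α) (x y d : α) (k : ℕ) :
    (u ++ [x, y] ++ v).getD (shiftIndex u.length k) d = (u ++ v).getD k d := by
  unfold shiftIndex
  split_ifs with h
  · rw [List.append_assoc, List.getD_append _ _ _ _ h, List.getD_append _ _ _ _ h]
  · push Not at h
    rw [List.getD_append_right _ _ _ _ h, List.getD_append_right _ _ _ _ (by simp; omega)]
    congr 1
    simp

theorem entry_comm (w : List Letter) (x y : Cyc) : entry w x y = entry w y x := by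
  rcases x with j | k <;> rcases y with j' | l <;> simp only [entry]
  by_cases h : k = l
  · subst h; simp
  · rw [if_neg h, if_neg (Ne.symm h)]
    congr 1
    apply propext
    constructor <;> rintro (⟨h1, h2⟩ | ⟨h1, h2⟩) <;> simp_all

section Insert

variable (u v : List Letter) (x y : Letter)

theorem colOf_insert_shiftIndex (k : ℕ) :
    colOf (u ++ [x, y] ++ v) (shiftIndex u.length k) = colOf (u ++ v) k := by
  unfold colOf; rw [getD_insert_shiftIndex]

theorem signOf_insert_shiftIndex (k : ℕ) :
    signOf (u ++ [x, y] ++ v) (shiftIndex u.length k) = signOf (u ++ v) k := by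
  unfold signOf; rw [getD_insert_shiftIndex]

theorem getD_insert_fst (d : Letter) : (u ++ [x, y] ++ v).getD u.length d = x := by
  simp

theorem getD_insert_snd (d : Letter) : (u ++ [x, y] ++ v).getD (u.length + 1) d = y := by
  simp

theorem entry_insert_shiftCyc (s t : Cyc) :
    entry (u ++ [x, y] ++ v) (shiftCyc u.length s) (shiftCyc u.length t) =
      entry (u ++ v) s t := by
  rcases s with j | k <;> rcases t with j' | l <;>
    simp only [shiftCyc, Sum.map_inl, Sum.map_inr, id, entry, colOf_insert_shiftIndex,
      signOf_insert_shiftIndex, shiftIndex_inj, shiftIndex_lt]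

theorem entry_insert_snd_eq_fst (hxy : x.1 = y.1) (s : Cyc) :
    entry (u ++ [x, y] ++ v) (shiftCyc u.length s) (Sum.inr (u.length + 1)) =
      entry (u ++ [x, y] ++ v) (shiftCyc u.length s) (Sum.inr u.length) := by
  have hx : colOf (u ++ [x, y] ++ v) u.length = x.1 := by
    unfold colOf; rw [getD_insert_fst]
  have hy : colOf (u ++ [x, y] ++ v) (u.length + 1) = x.1 := by
    unfold colOf; rw [getD_insert_snd, hxy]
  rcases s with j | k <;> simp only [shiftCyc, Sum.map_inl, Sum.map_inr, id, entry, hx, hy]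
  have h := shiftIndex_cases u.length k
  rw [if_neg (c := shiftIndex u.length k = u.length + 1) (by omega),
    if_neg (c := shiftIndex u.length k = u.length) (by omega)]
  exact if_congr (by omega) rfl rfl

end Insert

section LaundryList

variable {n : ℕ} {w : List Letter}

theorem mem_bandBlock {e : ℕ} {s : Cyc} :
    s ∈ bandBlock w e ↔
      ∃ k < w.length, (colOf w k = e - 1 ∨ colOf w k = e) ∧ s = Sum.inr k := by
  simp only [bandBlock, List.mem_map, List.mem_filter, List.mem_reverse, List.mem_range,
    Bool.or_eq_true, beq_iff_eq, and_assoc, eq_comm (a := s)]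

theorem nodup_bandBlock (w : List Letter) (e : ℕ) : (bandBlock w e).Nodup :=
  ((List.nodup_reverse.2 List.nodup_range).filter _).map Sum.inr_injective

theorem nodup_laundryList (n : ℕ) (w : List Letter) : (laundryList n w).Nodup := by
  unfold laundryList
  refine List.Nodup.append ?_ ?_ ?_
  · rw [List.nodup_flatMap]
    refine ⟨fun e _ => List.nodup_cons.2 ⟨by simp [mem_bandBlock], nodup_bandBlock w e⟩, ?_⟩
    refine ((List.nodup_range.filter _).imp_of_mem ?_)
    intro e e' he he' hne s hs hs'
    simp only [List.mem_filter, List.mem_range, Bool.and_eq_true, beq_iff_eq, bne_iff_ne] at he he'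
    simp only [List.mem_cons, mem_bandBlock] at hs hs'
    rcases hs with rfl | ⟨k, -, hk, rfl⟩ <;> rcases hs' with h | ⟨l, -, hl, h⟩
    · exact hne (Sum.inl_injective h)
    · simp at h
    · simp at h
    · obtain rfl := Sum.inr_injective h
      omega
  · exact (List.nodup_reverse.2 (List.nodup_range.filter _)).map Sum.inl_injective
  · intro s hs hs'
    simp only [List.mem_flatMap, List.mem_filter, List.mem_range, Bool.and_eq_true, beq_iff_eq,
      bne_iff_ne, List.mem_cons, mem_bandBlock, List.mem_map, List.mem_reverse] at hs hs'
    obtain ⟨j, hj, rfl⟩ := hs'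
    obtain ⟨e, he, h | ⟨k, -, -, h⟩⟩ := hs
    · obtain rfl := Sum.inl_injective h
      omega
    · simp at h

theorem IsBraidWord.colOf_bounds (hw : IsBraidWord n w) {k : ℕ} (hk : k < w.length) :
    1 ≤ colOf w k ∧ colOf w k + 1 ≤ n := by
  have h := hw.2.2 w[k] (List.getElem_mem hk)
  have h2 := hw.1
  rw [colOf, List.getD_eq_getElem _ _ hk]
  omega

theorem mem_laundryList_inl {j : ℕ} : Sum.inl j ∈ laundryList n w ↔ 1 ≤ j ∧ j ≤ n := by
  simp only [laundryList, List.mem_append, List.mem_flatMap, List.mem_filter, List.mem_range,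
    Bool.and_eq_true, beq_iff_eq, bne_iff_ne, List.mem_cons, mem_bandBlock, List.mem_map,
    List.mem_reverse, Sum.inl.injEq, reduceCtorEq, and_false, exists_false, or_false,
    exists_eq_right, exists_eq_right']
  omega

theorem IsBraidWord.mem_laundryList_inr (hw : IsBraidWord n w) {k : ℕ} :
    Sum.inr k ∈ laundryList n w ↔ k < w.length := by
  simp only [laundryList, List.mem_append, List.mem_flatMap, List.mem_filter, List.mem_range,
    Bool.and_eq_true, beq_iff_eq, bne_iff_ne, List.mem_cons, mem_bandBlock, List.mem_map,
    List.mem_reverse, Sum.inr.injEq, reduceCtorEq, and_false, exists_false, or_false, false_or]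
  constructor
  · rintro ⟨e, -, l, hl, -, rfl⟩
    exact hl
  · intro hk
    have := hw.colOf_bounds hk
    rcases Nat.even_or_odd' (colOf w k) with ⟨c, hc | hc⟩
    · exact ⟨colOf w k, by omega, k, hk, Or.inr rfl, rfl⟩
    · exact ⟨colOf w k + 1, by omega, k, hk, Or.inl rfl, rfl⟩

theorem IsBraidWord.length_laundryList (hw : IsBraidWord n w) :
    (laundryList n w).length = n + w.length := by
  have h : (laundryList n w).Perm
      ((List.range' 1 n).map Sum.inl ++ (List.range w.length).map Sum.inr) := by
    refine (List.perm_ext_iff_of_nodup (nodup_laundryList n w) ?_).2 ?_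
    · refine List.Nodup.append (List.Nodup.map Sum.inl_injective List.nodup_range')
        (List.nodup_range.map Sum.inr_injective) ?_
      intro s hs hs'
      simp only [List.mem_map] at hs hs'
      obtain ⟨_, _, rfl⟩ := hs
      simp at hs'
    · rintro (j | k)
      · simp [mem_laundryList_inl, List.mem_range'_1]
        omega
      · simp [hw.mem_laundryList_inr]
  simpa using h.length_eq

/-- Inserting two letters adds, up to order, the two corresponding bands to the cycles. -/
theorem laundryList_insert_perm {u v : List Letter} {x y : Letter}
    (hw : IsBraidWord n (u ++ v)) (hw' : IsBraidWord n (u ++ [x, y] ++ v)) :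
    ((laundryList n (u ++ v)).map (shiftCyc u.length) ++
        [Sum.inr u.length, Sum.inr (u.length + 1)]).Perm
      (laundryList n (u ++ [x, y] ++ v)) := by
  refine (List.perm_ext_iff_of_nodup ?_ (nodup_laundryList _ _)).2 ?_
  · refine List.Nodup.append ((nodup_laundryList _ _).map (shiftCyc_injective _)) (by simp) ?_
    intro s hs hs'
    simp only [List.mem_map] at hs
    obtain ⟨j | k, -, rfl⟩ := hs
    · simp [shiftCyc] at hs'
    · have := shiftIndex_cases u.length k
      simp [shiftCyc] at hs'
      omega
  · rintro (j | k)
    · simp [shiftCyc, mem_laundryList_inl]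
    · rw [hw'.mem_laundryList_inr]
      simp only [List.mem_append, List.mem_map, Sum.exists, shiftCyc, Sum.map_inl, Sum.map_inr,
        reduceCtorEq, and_false, exists_false, false_or, hw.mem_laundryList_inr,
        List.length_append, List.length_cons, List.length_nil, List.mem_nil_iff, List.mem_cons,
        Sum.inr.injEq, or_false]
      constructor
      · rintro (⟨l, hl, rfl⟩ | h)
        · unfold shiftIndex; split_ifs <;> omega
        · omega
      · intro hk
        by_cases h1 : k < u.length
        · exact Or.inl ⟨k, by omega, if_pos h1⟩
        · by_cases h2 : k < u.length + 2
          · omega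
          · exact Or.inl ⟨k - 2, by omega, by rw [shiftIndex, if_neg (by omega)]; omega⟩

end LaundryList

theorem List.Perm.exists_equiv_getD {α : Type*} {l₁ l₂ : List α} (h : l₁.Perm l₂)
    (hl : l₁.Nodup) {N : ℕ} (hN : l₁.length = N) (d : α) :
    ∃ σ : Fin N ≃ Fin N, ∀ p, l₂.getD (σ p) d = l₁.getD p d := by
  classical
  subst hN
  refine ⟨(List.Nodup.getEquiv l₁ hl).trans ((Equiv.subtypeEquivRight fun _ => h.mem_iff).trans
    ((List.Nodup.getEquiv l₂ (h.nodup_iff.1 hl)).symm.trans (finCongr h.length_eq.symm))), ?_⟩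
  intro p
  have h1 : List.idxOf l₁[p] l₂ < l₂.length := List.idxOf_lt_length_of_mem (h.subset (by simp))
  have h2 : l₂[List.idxOf l₁[p] l₂]? = some l₁[p] := by
    rw [List.getElem?_eq_getElem h1, List.getElem_idxOf h1]
  simpa using congrArg (Option.getD · d) h2

/-- A symmetric integer matrix with two indices whose rows agree off a diagonal block
`diag(ε, -ε)` is congruent to a tube addition on the remaining indices. -/
theorem exists_congruence_tubeAdd {s : ℕ} (A : Matrix (Fin s) (Fin s) ℤ)
    (M : Matrix (Fin (s + 2)) (Fin (s + 2)) ℤ) (ε : ℤ) (hε : ε = 1 ∨ ε = -1)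
    (σ : Fin s ⊕ Fin 2 ≃ Fin (s + 2)) (r : Fin s → ℤ)
    (hM : M.submatrix σ σ = fromBlocks A (of fun p _ => r p) (of fun _ p => r p)
      !![ε, 0; 0, -ε]) :
    ∃ P : Matrix (Fin (s + 2)) (Fin (s + 2)) ℤ,
      (P.det = 1 ∨ P.det = -1) ∧ M = Pᵀ * tubeAdd A ε * P := by
  set Q : Matrix (Fin s ⊕ Fin 2) (Fin s ⊕ Fin 2) ℤ :=
    fromBlocks 1 0 (of ![0, r]) !![1, 1; 0, -ε] with hQ
  refine ⟨Q.submatrix finSumFinEquiv.symm σ.symm, ?_, ?_⟩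
  · have h : |(Q.submatrix finSumFinEquiv.symm σ.symm).det| = 1 := by
      rw [abs_det_submatrix_equiv_equiv, hQ, det_fromBlocks_zero₁₂, det_fin_two]
      rcases hε with rfl | rfl <;> simp
    exact (abs_eq zero_le_one).1 h
  · have key : M.submatrix σ σ = Qᵀ * fromBlocks A 0 0 !![ε, 1; 1, 0] * Q := by
      have hεε : ε * ε = 1 := by rcases hε with rfl | rfl <;> rfl
      rw [hM, hQ, fromBlocks_transpose, fromBlocks_multiply, fromBlocks_multiply]
      congr 1
      · ext p q
        simp [Matrix.mul_apply, Fin.sum_univ_two]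
      · ext p q
        fin_cases q <;> simp [Matrix.mul_apply, Fin.sum_univ_two]
      · ext p q
        fin_cases p <;> simp [Matrix.mul_apply, Fin.sum_univ_two]
      · ext p q
        fin_cases p <;> fin_cases q <;> simp [Matrix.mul_apply, Fin.sum_univ_two]
    have hM' : M = (M.submatrix σ σ).submatrix σ.symm σ.symm := by simp
    rw [hM', key, tubeAdd, reindex_apply, transpose_submatrix, submatrix_mul_equiv,
      submatrix_mul_equiv]

/-- **type II Reidemeister move M1.** Inserting a cancelling pair
`σ_i^ε σ_i^{-ε}` changes the linking matrix by a tube addition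
`M(w) ↦ M(w) ⊕ [[b, 1], [1, 0]]` up to unimodular congruence. -/
theorem linkMat_reidemeisterII_tube_addition (n m : ℕ) (u v : List Letter)
    (i : ℕ) (hi : 1 ≤ i ∧ i ≤ n - 1) (ε : ℤ) (hε : ε = 1 ∨ ε = -1)
    (hw : IsBraidWord n (u ++ v))
    (hw' : IsBraidWord n (u ++ [(i, ε), (i, -ε)] ++ v))
    (hm : (u ++ v).length = m) :
    ∃ b : ℤ, ∃ P : Matrix (Fin (n + m + 2)) (Fin (n + m + 2)) ℤ,
      (P.det = 1 ∨ P.det = -1) ∧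
      linkMat n (m + 2) (u ++ [(i, ε), (i, -ε)] ++ v) =
        Pᵀ * tubeAdd (linkMat n m (u ++ v)) b * P := by
  have hperm := laundryList_insert_perm hw hw'
  have hL : (laundryList n (u ++ v)).length = n + m := hm ▸ hw.length_laundryList
  obtain ⟨σ, hσ⟩ := hperm.exists_equiv_getD (hperm.nodup_iff.2 (nodup_laundryList _ _))
    (N := n + m + 2) (by simp [hL]) (Sum.inl 0)
  set w' := u ++ [(i, ε), (i, -ε)] ++ v with hw'_def
  have hinl (p : Fin (n + m)) :
      (laundryList n w').getD (σ (finSumFinEquiv (Sum.inl p))) (Sum.inl 0) =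
        shiftCyc u.length ((laundryList n (u ++ v)).getD p (Sum.inl 0)) := by
    rw [hσ, finSumFinEquiv_apply_left, Fin.val_castAdd,
      List.getD_append _ _ _ _ (by simp [hL])]
    exact List.getD_map _ (Sum.inl 0) (shiftCyc u.length)
  have hinr (p : Fin 2) :
      (laundryList n w').getD (σ (finSumFinEquiv (Sum.inr p))) (Sum.inl 0) =
        Sum.inr (u.length + p) := by
    rw [hσ, finSumFinEquiv_apply_right, Fin.val_natAdd,
      List.getD_append_right _ _ _ _ (by simp [hL])]
    fin_cases p <;> simp [hL]
  have hcol (p : Fin (n + m)) (q : Fin 2) :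
      entry w' (shiftCyc u.length ((laundryList n (u ++ v)).getD p (Sum.inl 0)))
          (Sum.inr (u.length + q)) =
        entry w' (shiftCyc u.length ((laundryList n (u ++ v)).getD p (Sum.inl 0)))
          (Sum.inr u.length) := by
    fin_cases q
    · rfl
    · exact entry_insert_snd_eq_fst u v (i, ε) (i, -ε) rfl _
  refine ⟨ε, exists_congruence_tubeAdd _ _ ε hε (finSumFinEquiv.trans σ) (fun p =>
    entry w' (shiftCyc u.length ((laundryList n (u ++ v)).getD p (Sum.inl 0)))
      (Sum.inr u.length)) ?_⟩
  ext (p | p) (q | q)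
  · simp only [submatrix_apply, Equiv.trans_apply, linkMat, hinl, fromBlocks_apply₁₁]
    exact entry_insert_shiftCyc u v _ _ _ _
  · simp only [submatrix_apply, Equiv.trans_apply, linkMat, hinl, hinr, fromBlocks_apply₁₂,
      of_apply, hcol]
  · simp only [submatrix_apply, Equiv.trans_apply, linkMat, hinl, hinr, fromBlocks_apply₂₁,
      of_apply]
    rw [entry_comm, hcol]
  · simp only [submatrix_apply, Equiv.trans_apply, linkMat, hinr, fromBlocks_apply₂₂]
    fin_cases p <;> fin_cases q <;> simp [entry, signOf, colOf, hw'_def]
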